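/- Let g∈𝒮(ℝⁿ). For every N≥0 there exist a constant C_N>0 and an integer k∈ℕ, depending only on g, N and n, such that for all ħ∈(0,1] (h=2πħ), all f∈𝒮(ℝⁿ), and all z∈ℝ^{2n}: |⟨f, 𝒯̂^ħ(z)g^h⟩| ≤ C_N ‖D_{h^{1/2}}f‖_k (1+|h^{−1/2}z|²)^{−N/2}, where ‖φ‖_k = Σ_{|α|≤k} sup_{x∈ℝⁿ}(1+|x|^k)|∂^α φ(x)|. In particular, if ℬ⊂𝒮(ℝⁿ) is a family of functions with ‖D_{h^{1/2}}f‖_k uniformly bounded for each k (uniformly in f∈ℬ and ħ∈(0,1]), then the decay estimate holds with a constant independent of ħ and of f∈ℬ. -/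

import Mathlib

noncomputable section
open MeasureTheory Filter Complex Real
open scoped ComplexConjugate BigOperators NNReal ENNReal

namespace SC

variable {n : ℕ}

abbrev Rn (n : ℕ) := Fin n → ℝ
abbrev Ph (n : ℕ) := (Fin n → ℝ) × (Fin n → ℝ)

/-- Euclidean dot product on ℝⁿ. -/
def dot (x y : Rn n) : ℝ := ∑ i, x i * y i

/-- squared Euclidean norm on ℝⁿ. -/
def sq (x : Rn n) : ℝ := ∑ i, x i ^ 2

/-- squared Euclidean norm on phase space ℝ^{2n}. -/
def sq2 (z : Ph n) : ℝ := sq z.1 + sq z.2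

/-- translation operator T_x. -/
def Tr (x : Rn n) (f : Rn n → ℂ) : Rn n → ℂ := fun t => f (t - x)

/-- modulation operator M_ξ. -/
def Mo (ξ : Rn n) (f : Rn n → ℂ) : Rn n → ℂ :=
  fun t => Complex.exp (2 * (Real.pi : ℂ) * Complex.I * ((dot ξ t : ℝ) : ℂ)) * f t

/-- dilation operator D_λ. -/
def Dil (lam : ℝ) (f : Rn n → ℂ) : Rn n → ℂ :=
  fun x => ((lam ^ ((n : ℝ) / 2) : ℝ) : ℂ) * f (lam • x)

/-- Weyl–Heisenberg operator 𝒯̂^ħ(z). -/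
def WH (hbar : ℝ) (z : Ph n) (f : Rn n → ℂ) : Rn n → ℂ :=
  fun x => Complex.exp (Complex.I * ((hbar⁻¹ * (dot z.2 x - dot z.1 z.2 / 2) : ℝ) : ℂ)) * f (x - z.1)

/-- 𝒯̂ = 𝒯̂^{1/(2π)}. -/
def T1 (z : Ph n) (f : Rn n → ℂ) : Rn n → ℂ := WH (1 / (2 * Real.pi)) z f

/-- L² inner product ⟨f,g⟩ = ∫ f ⋅ conj g. -/
def l2inner (f g : Rn n → ℂ) : ℂ := ∫ t, f t * conj (g t)

/-- ‖f‖₂². -/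
def l2normSq (f : Rn n → ℂ) : ℝ := ∫ t, ‖f t‖ ^ 2

/-- rescaled window g^h = D_{h^{-1/2}} g. -/
def gh (h : ℝ) (g : Rn n → ℂ) : Rn n → ℂ := Dil (Real.sqrt h)⁻¹ g

/-- coercion of integer lattice point. -/
def iC (k : Fin n → ℤ) : Rn n := fun i => (k i : ℝ)

/-- A and B are frame bounds for the system of atoms. -/
def FrameBounds {ι : Type} (A B : ℝ) (atom : ι → Rn n → ℂ) : Prop :=
  ∀ f : Rn n → ℂ, MemLp f 2 volume →
    ENNReal.ofReal (A * l2normSq f) ≤ ∑' i, (‖l2inner f (atom i)‖₊ : ℝ≥0∞) ^ 2 ∧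
    ∑' i, (‖l2inner f (atom i)‖₊ : ℝ≥0∞) ^ 2 ≤ ENNReal.ofReal (B * l2normSq f)

/-- the system of atoms is a frame for L²(ℝⁿ). -/
def IsFrame {ι : Type} (atom : ι → Rn n → ℂ) : Prop :=
  ∃ A B : ℝ, 0 < A ∧ A ≤ B ∧ FrameBounds A B atom

/-- Gabor atoms T_{αk} M_{βm} g, indexed by (k,m) ∈ ℤⁿ×ℤⁿ. -/
def gaborAtom (α β : ℝ) (g : Rn n → ℂ) (km : (Fin n → ℤ) × (Fin n → ℤ)) : Rn n → ℂ :=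
  Tr (α • iC km.1) (Mo (β • iC km.2) g)

/-- the standard Gaussian ψ₀. -/
def ψ₀ : Rn n → ℂ :=
  fun x => (((2 : ℝ) ^ ((n : ℝ) / 4) : ℝ) : ℂ) * Complex.exp ((-(Real.pi * sq x) : ℝ) : ℂ)




/-- the Schwartz seminorm ‖φ‖_k = Σ_{|α|≤k} sup_x (1+|x|^k)|∂^α φ(x)| (with the derivatives
of order j encoded by the j-th iterated Fréchet derivative). -/
def schNorm (k : ℕ) (φ : Rn n → ℂ) : ℝ :=
  ∑ j ∈ Finset.range (k + 1),
    ⨆ x : Rn n, (1 + Real.sqrt (sq x) ^ k) * ‖iteratedFDeriv ℝ j φ x‖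

lemma sq_nonneg' (x : Rn n) : 0 ≤ sq x := Finset.sum_nonneg fun _ _ => sq_nonneg _

lemma sq_le (x : Rn n) : sq x ≤ n * ‖x‖ ^ 2 := by
  unfold sq
  calc ∑ i, x i ^ 2 ≤ ∑ _i : Fin n, ‖x‖ ^ 2 := by
        refine Finset.sum_le_sum fun i _ => ?_
        rw [← sq_abs]
        exact pow_le_pow_left₀ (abs_nonneg _) (norm_le_pi_norm x i) 2
    _ = n * ‖x‖ ^ 2 := by simp

lemma norm_le_sqrt (x : Rn n) : ‖x‖ ≤ Real.sqrt (sq x) := by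
  rw [pi_norm_le_iff_of_nonneg (Real.sqrt_nonneg _)]
  intro i
  apply Real.le_sqrt_of_sq_le
  rw [Real.norm_eq_abs, sq_abs]
  exact Finset.single_le_sum (f := fun i => x i ^ 2) (fun _ _ => sq_nonneg _) (Finset.mem_univ i)

lemma sqrt_le (x : Rn n) : Real.sqrt (sq x) ≤ (n + 1) * ‖x‖ := by
  apply Real.sqrt_le_iff.2 ⟨by positivity, ?_⟩
  refine (sq_le x).trans ?_
  rw [mul_pow]
  gcongr
  have : (0:ℝ) ≤ n := Nat.cast_nonneg n
  nlinarith

lemma bdd (F : SchwartzMap (Rn n) ℂ) (k j : ℕ) :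
    BddAbove (Set.range fun x : Rn n => (1 + Real.sqrt (sq x) ^ k) * ‖iteratedFDeriv ℝ j F x‖) := by
  obtain ⟨C0, h0⟩ := F.decay' 0 j
  obtain ⟨C1, h1⟩ := F.decay' k j
  refine ⟨C0 + (n + 1) ^ k * C1, ?_⟩
  rintro _ ⟨x, rfl⟩
  have h0x := h0 x
  have h1x := h1 x
  simp only [pow_zero, one_mul] at h0x
  have hs : Real.sqrt (sq x) ^ k ≤ (n + 1) ^ k * ‖x‖ ^ k := by
    rw [← mul_pow]
    exact pow_le_pow_left₀ (Real.sqrt_nonneg _) (sqrt_le x) k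
  calc (1 + Real.sqrt (sq x) ^ k) * ‖iteratedFDeriv ℝ j F x‖
      ≤ (1 + (n + 1) ^ k * ‖x‖ ^ k) * ‖iteratedFDeriv ℝ j F x‖ := by gcongr
    _ = ‖iteratedFDeriv ℝ j F x‖ + (n + 1) ^ k * (‖x‖ ^ k * ‖iteratedFDeriv ℝ j F x‖) := by ring
    _ ≤ _ := by
      refine add_le_add h0x ?_
      exact mul_le_mul_of_nonneg_left h1x (by positivity)

lemma schNorm_nonneg (k : ℕ) (φ : Rn n → ℂ) : 0 ≤ schNorm k φ :=
  Finset.sum_nonneg fun _ _ => Real.iSup_nonneg fun _ => by positivity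

lemma le_schNorm (F : SchwartzMap (Rn n) ℂ) (k j : ℕ) (hj : j ≤ k) (x : Rn n) :
    (1 + ‖x‖) ^ k * ‖iteratedFDeriv ℝ j F x‖ ≤ 2 ^ k * schNorm k F := by
  have h1 : (1 + Real.sqrt (sq x) ^ k) * ‖iteratedFDeriv ℝ j F x‖ ≤ schNorm k F := by
    refine (le_ciSup (bdd F k j) x).trans ?_
    exact Finset.single_le_sum
      (f := fun j => ⨆ x : Rn n, (1 + Real.sqrt (sq x) ^ k) * ‖iteratedFDeriv ℝ j F x‖)
      (fun _ _ => Real.iSup_nonneg fun _ => by positivity) (Finset.mem_range.2 (by omega))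
  have h2 : (1 + ‖x‖) ^ k ≤ 2 ^ k * (1 + Real.sqrt (sq x) ^ k) := by
    refine (add_pow_le zero_le_one (norm_nonneg x) k).trans ?_
    rw [one_pow]
    have := pow_le_pow_left₀ (norm_nonneg x) (norm_le_sqrt x) k
    have h3 : (2:ℝ) ^ (k - 1) ≤ 2 ^ k := pow_le_pow_right₀ one_le_two (by omega)
    gcongr
  calc _ ≤ 2 ^ k * (1 + Real.sqrt (sq x) ^ k) * ‖iteratedFDeriv ℝ j F x‖ := by gcongr
    _ = 2 ^ k * ((1 + Real.sqrt (sq x) ^ k) * ‖iteratedFDeriv ℝ j F x‖) := by ring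
    _ ≤ _ := by gcongr

/-- the product `F · conj (T_a g)`. -/
def GG (F g : SchwartzMap (Rn n) ℂ) (a : Rn n) : Rn n → ℂ := fun u => F u * conj (g (u - a))

lemma contDiff_shift (g : SchwartzMap (Rn n) ℂ) (a : Rn n) :
    ContDiff ℝ (⊤ : ℕ∞) (fun u : Rn n => conj (g (u - a))) := by
  have h1 : ContDiff ℝ (⊤ : ℕ∞) (fun u : Rn n => g (u - a)) :=
    (g.smooth ⊤).comp (contDiff_id.sub contDiff_const)
  exact Complex.conjLIE.toContinuousLinearEquiv.contDiff.comp h1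

lemma contDiff_GG (F g : SchwartzMap (Rn n) ℂ) (a : Rn n) :
    ContDiff ℝ (⊤ : ℕ∞) (GG F g a) := (F.smooth ⊤).mul (contDiff_shift g a)

lemma norm_shift (g : SchwartzMap (Rn n) ℂ) (a u : Rn n) (j : ℕ) :
    ‖iteratedFDeriv ℝ j (fun u : Rn n => conj (g (u - a))) u‖ = ‖iteratedFDeriv ℝ j g (u - a)‖ := by
  have := Complex.conjLIE.norm_iteratedFDeriv_comp_left (𝕜 := ℝ) (fun u : Rn n => g (u - a)) u j
  rw [iteratedFDeriv_comp_sub] at this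
  rw [← this]
  rfl

lemma GG_bound (g : SchwartzMap (Rn n) ℂ) (M : ℕ) : ∃ C : ℝ, 0 ≤ C ∧
    ∀ F : SchwartzMap (Rn n) ℂ, ∀ a u : Rn n, ∀ j ≤ M,
    (1 + ‖a‖) ^ M * ‖iteratedFDeriv ℝ j (GG F g a) u‖ ≤
      C * schNorm (M + n + 1) F * (1 + ‖u‖) ^ (-((n : ℝ) + 1)) := by
  set D : ℝ := 2 ^ M * (Finset.Iic (M, M)).sup (fun m => SchwartzMap.seminorm ℝ m.1 m.2) g with hD
  have hDn : 0 ≤ D := mul_nonneg (by positivity) (apply_nonneg _ _)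
  refine ⟨2 ^ M * (2 ^ (M + n + 1) * D), by positivity, fun F a u j hj => ?_⟩
  set S := schNorm (M + n + 1) F
  have hS : 0 ≤ S := schNorm_nonneg _ _
  have hP : 0 < 1 + ‖u‖ := by positivity
  have hA : 1 + ‖a‖ ≤ (1 + ‖u‖) * (1 + ‖u - a‖) := by
    have : ‖a‖ ≤ ‖u‖ + ‖u - a‖ := by
      calc ‖a‖ = ‖u - (u - a)‖ := by congr 1; abel
        _ ≤ _ := norm_sub_le _ _
    nlinarith [mul_nonneg (norm_nonneg u) (norm_nonneg (u - a))]
  have term : ∀ i ≤ j, (1 + ‖a‖) ^ M * (1 + ‖u‖) ^ (n + 1) *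
      (‖iteratedFDeriv ℝ i F u‖ * ‖iteratedFDeriv ℝ (j - i) g (u - a)‖)
      ≤ 2 ^ (M + n + 1) * S * D := by
    intro i hi
    have h1 := le_schNorm F (M + n + 1) i (by omega) u
    have h2 := SchwartzMap.one_add_le_sup_seminorm_apply (𝕜 := ℝ) (m := (M, M)) (k := M)
      (n := j - i) le_rfl (by simp; omega) g (u - a)
    calc _ ≤ ((1 + ‖u‖) * (1 + ‖u - a‖)) ^ M * (1 + ‖u‖) ^ (n + 1) *
      (‖iteratedFDeriv ℝ i F u‖ * ‖iteratedFDeriv ℝ (j - i) g (u - a)‖) := by gcongr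
      _ = ((1 + ‖u‖) ^ (M + n + 1) * ‖iteratedFDeriv ℝ i F u‖) *
        ((1 + ‖u - a‖) ^ M * ‖iteratedFDeriv ℝ (j - i) g (u - a)‖) := by
          rw [mul_pow]; ring
      _ ≤ _ := mul_le_mul h1 h2 (by positivity) (by positivity)
  have key : (1 + ‖a‖) ^ M * (1 + ‖u‖) ^ (n + 1) * ‖iteratedFDeriv ℝ j (GG F g a) u‖ ≤
      2 ^ M * (2 ^ (M + n + 1) * S * D) := by
    have h := norm_iteratedFDeriv_mul_le (F.smooth ⊤) (contDiff_shift g a) u (n := j)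
      (by exact_mod_cast le_top)
    calc _ ≤ (1 + ‖a‖) ^ M * (1 + ‖u‖) ^ (n + 1) * ∑ i ∈ Finset.range (j + 1),
          (j.choose i : ℝ) * ‖iteratedFDeriv ℝ i F u‖ *
          ‖iteratedFDeriv ℝ (j - i) (fun u : Rn n => conj (g (u - a))) u‖ := by
            exact mul_le_mul_of_nonneg_left h (by positivity)
      _ = ∑ i ∈ Finset.range (j + 1), (j.choose i : ℝ) * ((1 + ‖a‖) ^ M * (1 + ‖u‖) ^ (n + 1) *
          (‖iteratedFDeriv ℝ i F u‖ * ‖iteratedFDeriv ℝ (j - i) g (u - a)‖)) := by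
            rw [Finset.mul_sum]
            refine Finset.sum_congr rfl fun i _ => ?_
            rw [norm_shift]; ring
      _ ≤ ∑ i ∈ Finset.range (j + 1), (j.choose i : ℝ) * (2 ^ (M + n + 1) * S * D) := by
            refine Finset.sum_le_sum fun i hi => ?_
            exact mul_le_mul_of_nonneg_left (term i (by simp at hi; omega)) (by positivity)
      _ = 2 ^ j * (2 ^ (M + n + 1) * S * D) := by
            rw [← Finset.sum_mul]
            congr 1
            exact_mod_cast Nat.sum_range_choose j
      _ ≤ _ := by
            have : (2:ℝ) ^ j ≤ 2 ^ M := pow_le_pow_right₀ one_le_two hj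
            gcongr
  have e : (1 + ‖u‖) ^ (-((n : ℝ) + 1)) = ((1 + ‖u‖) ^ (n + 1))⁻¹ := by
    rw [Real.rpow_neg hP.le]
    congr 1
    exact_mod_cast Real.rpow_natCast (1 + ‖u‖) (n + 1)
  rw [e, ← div_eq_mul_inv, le_div_iff₀ (by positivity)]
  linarith

lemma int_w : Integrable (fun u : Rn n => (1 + ‖u‖) ^ (-((n : ℝ) + 1))) :=
  integrable_one_add_norm (by simp)

/-- the dot product as a continuous bilinear map. -/
def LL : Rn n →L[ℝ] Rn n →L[ℝ] ℝ :=
  ∑ i, (ContinuousLinearMap.proj (R := ℝ) (φ := fun _ : Fin n => ℝ) i).smulRight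
    (ContinuousLinearMap.proj (R := ℝ) (φ := fun _ : Fin n => ℝ) i)

lemma LL_apply (v w : Rn n) : LL v w = dot v w := by
  simp [LL, dot]

lemma GG_int (F g : SchwartzMap (Rn n) ℂ) (a : Rn n) (j : ℕ) :
    Integrable (fun u => ‖iteratedFDeriv ℝ j (GG F g a) u‖) := by
  obtain ⟨C, hC, h⟩ := GG_bound g j
  refine (int_w.const_mul (C * schNorm (j + n + 1) F)).mono' ?_ ?_
  · exact (((contDiff_GG F g a).continuous_iteratedFDeriv
      (by exact_mod_cast le_top)).norm).aestronglyMeasurable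
  · refine Eventually.of_forall fun u => ?_
    rw [norm_norm]
    refine le_trans ?_ (h F a u j le_rfl)
    exact le_mul_of_one_le_left (norm_nonneg _) (one_le_pow₀ (by linarith [norm_nonneg a]))

lemma key (g : SchwartzMap (Rn n) ℂ) (M : ℕ) : ∃ C : ℝ, 0 ≤ C ∧
    ∀ F : SchwartzMap (Rn n) ℂ, ∀ a b : Rn n,
    ((1 + ‖a‖) * (1 + ‖b‖)) ^ M *
      ‖VectorFourier.fourierIntegral Real.fourierChar volume LL.toLinearMap₁₂ (GG F g a) b‖ ≤
      C * schNorm (M + n + 1) F := by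
  obtain ⟨C, hC, h⟩ := GG_bound g M
  set W : ℝ := ∫ u : Rn n, (1 + ‖u‖) ^ (-((n : ℝ) + 1)) with hW
  have hWn : 0 ≤ W := integral_nonneg fun u => by positivity
  refine ⟨2 ^ M * (C * W + (C * W + 2 ^ M * ((M + 1) * (C * W)))), by positivity, fun F a b => ?_⟩
  set S := schNorm (M + n + 1) F with hS
  have hSn : 0 ≤ S := schNorm_nonneg _ _
  set V := VectorFourier.fourierIntegral Real.fourierChar volume LL.toLinearMap₁₂ (GG F g a) b with hV
  have hj : ∀ j ≤ M, (1 + ‖a‖) ^ M * ∫ u, ‖iteratedFDeriv ℝ j (GG F g a) u‖ ≤ C * W * S := by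
    intro j hj
    rw [← integral_const_mul]
    calc _ ≤ ∫ u : Rn n, C * S * (1 + ‖u‖) ^ (-((n : ℝ) + 1)) :=
          integral_mono ((GG_int F g a j).const_mul _) (int_w.const_mul _) fun u => h F a u j hj
      _ = _ := by rw [integral_const_mul]; ring
  have gen : ∀ (m : ℕ) (v : Rn n), m ≤ M → ‖v‖ ≤ 1 → |LL v b| ^ m * ‖V‖ ≤
      2 ^ m * ∑ p ∈ Finset.range (m + 1), ∫ u, ‖iteratedFDeriv ℝ p (GG F g a) u‖ := by
    intro m v hm hv
    have := VectorFourier.pow_mul_norm_iteratedFDeriv_fourierIntegral_le (μ := volume) (K := 0)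
      (N := ⊤) LL (contDiff_GG F g a) (fun k j hk _ => by
        have : k = 0 := by exact_mod_cast nonpos_iff_eq_zero.1 hk
        subst this
        simpa using GG_int F g a j) (k := 0) (n := m) (by simp) (by exact_mod_cast le_top) v b
    simp only [norm_iteratedFDeriv_zero, pow_zero, mul_one, Nat.cast_zero, mul_zero, zero_add,
      Finset.sum_product, Finset.range_one, Finset.sum_singleton, one_mul] at this
    refine this.trans ?_
    have h1 : ‖v‖ ^ m ≤ 1 := pow_le_one₀ (norm_nonneg _) hv
    have h2 : 0 ≤ (2:ℝ) ^ m * ∑ p ∈ Finset.range (m + 1), ∫ u, ‖iteratedFDeriv ℝ p (GG F g a) u‖ :=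
      mul_nonneg (by positivity) (Finset.sum_nonneg fun _ _ => integral_nonneg fun _ => norm_nonneg _)
    rw [mul_assoc]
    exact mul_le_of_le_one_left h2 h1
  have g0 : (1 + ‖a‖) ^ M * ‖V‖ ≤ C * W * S := by
    have := gen 0 0 (Nat.zero_le _) (by simp)
    simp only [pow_zero, one_mul, zero_add, Finset.range_one, Finset.sum_singleton] at this
    refine le_trans ?_ (hj 0 (Nat.zero_le _))
    gcongr
  have g1 : (1 + ‖a‖) ^ M * (‖b‖ ^ M * ‖V‖) ≤ C * W * S + 2 ^ M * ((M + 1) * (C * W * S)) := by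
    have hrest : 0 ≤ C * W * S := by positivity
    rcases isEmpty_or_nonempty (Fin n) with he | hne
    · have hb : ‖b‖ = 0 := by rw [Subsingleton.elim b 0]; simp
      have hb1 : ‖b‖ ^ M ≤ 1 := pow_le_one₀ (norm_nonneg _) (by rw [hb]; exact zero_le_one)
      have : (1 + ‖a‖) ^ M * (‖b‖ ^ M * ‖V‖) ≤ (1 + ‖a‖) ^ M * ‖V‖ := by
        gcongr
        exact mul_le_of_le_one_left (norm_nonneg _) hb1
      have h3 : 0 ≤ (2:ℝ) ^ M * ((M + 1) * (C * W * S)) := by positivity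
      linarith
    · obtain ⟨i, hi⟩ := (IsGreatest.pi_norm b).1
      have hi' : |LL (Pi.single i 1) b| = ‖b‖ := by
        rw [LL_apply, ← hi]
        simp [dot, Pi.single_apply]
      have := gen M (Pi.single i 1) le_rfl (by
        rw [pi_norm_le_iff_of_nonneg zero_le_one]
        intro j
        rcases eq_or_ne j i with rfl | hji
        · simp
        · simp [Pi.single_eq_of_ne hji])
      rw [hi'] at this
      have h4 : (1 + ‖a‖) ^ M * (‖b‖ ^ M * ‖V‖) ≤ 2 ^ M * ((M + 1) * (C * W * S)) := by
        calc _ ≤ (1 + ‖a‖) ^ M * (2 ^ M * ∑ p ∈ Finset.range (M + 1),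
                ∫ u, ‖iteratedFDeriv ℝ p (GG F g a) u‖) := by gcongr
          _ = 2 ^ M * ∑ p ∈ Finset.range (M + 1),
                (1 + ‖a‖) ^ M * ∫ u, ‖iteratedFDeriv ℝ p (GG F g a) u‖ := by
              rw [← Finset.mul_sum]; ring
          _ ≤ 2 ^ M * ∑ p ∈ Finset.range (M + 1), C * W * S := by
              refine mul_le_mul_of_nonneg_left (Finset.sum_le_sum fun p hp => ?_) (by positivity)
              exact hj p (by simp at hp; omega)
          _ = _ := by simp
      linarith
  have h2 : (1 + ‖b‖) ^ M ≤ 2 ^ M * (1 + ‖b‖ ^ M) := by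
    refine (add_pow_le zero_le_one (norm_nonneg b) M).trans ?_
    rw [one_pow]
    have h3 : (2:ℝ) ^ (M - 1) ≤ 2 ^ M := pow_le_pow_right₀ one_le_two (by omega)
    gcongr
  calc _ = (1 + ‖a‖) ^ M * ((1 + ‖b‖) ^ M * ‖V‖) := by rw [mul_pow]; ring
    _ ≤ (1 + ‖a‖) ^ M * (2 ^ M * (1 + ‖b‖ ^ M) * ‖V‖) := by gcongr
    _ = 2 ^ M * ((1 + ‖a‖) ^ M * ‖V‖ + (1 + ‖a‖) ^ M * (‖b‖ ^ M * ‖V‖)) := by ring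
    _ ≤ 2 ^ M * (C * W * S + (C * W * S + 2 ^ M * ((M + 1) * (C * W * S)))) := by gcongr
    _ = _ := by ring

/-- the dilation of a Schwartz function. -/
def DilS (s : ℝ) (hs : s ≠ 0) (f : SchwartzMap (Rn n) ℂ) : SchwartzMap (Rn n) ℂ :=
  ((s ^ ((n : ℝ) / 2) : ℝ) : ℂ) • SchwartzMap.compCLMOfContinuousLinearEquiv ℂ
    (LinearEquiv.smulOfNeZero ℝ (Rn n) s hs).toContinuousLinearEquiv f

lemma DilS_coe (s : ℝ) (hs : s ≠ 0) (f : SchwartzMap (Rn n) ℂ) : ⇑(DilS s hs f) = Dil s f := by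
  ext x
  simp [DilS, Dil]

lemma dot_smul (c : ℝ) (x y : Rn n) : dot x (c • y) = c * dot x y := by
  simp only [dot, Finset.mul_sum, Pi.smul_apply, smul_eq_mul]
  exact Finset.sum_congr rfl fun _ _ => by ring

lemma smul_dot (c : ℝ) (x y : Rn n) : dot (c • x) y = c * dot x y := by
  simp only [dot, Finset.mul_sum, Pi.smul_apply, smul_eq_mul]
  exact Finset.sum_congr rfl fun _ _ => by ring

lemma dot_comm' (x y : Rn n) : dot x y = dot y x := by
  simp only [dot, mul_comm]

lemma reduce (f g : SchwartzMap (Rn n) ℂ) (hbar s : ℝ) (hb : 0 < hbar) (hs : 0 < s)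
    (hsq : s ^ 2 = 2 * Real.pi * hbar) (z : Ph n) :
    ‖l2inner f (WH hbar z (Dil s⁻¹ g))‖ =
    ‖VectorFourier.fourierIntegral Real.fourierChar volume LL.toLinearMap₁₂
      (GG (DilS s hs.ne' f) g (s⁻¹ • z.1)) (s⁻¹ • z.2)‖ := by
  have hcv := Measure.integral_comp_smul (volume : Measure (Rn n))
    (fun t => f t * conj (WH hbar z (Dil s⁻¹ g) t)) s
  have hsn : (s ^ ((n : ℝ) / 2)) ≠ 0 := (Real.rpow_pos_of_pos hs _).ne'
  have hpw : s ^ n = s ^ ((n : ℝ) / 2) * s ^ ((n : ℝ) / 2) := by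
    rw [← Real.rpow_add hs, add_halves, Real.rpow_natCast]
  have h1 : l2inner f (WH hbar z (Dil s⁻¹ g)) =
      (s ^ n : ℝ) • ∫ u : Rn n, f (s • u) * conj (WH hbar z (Dil s⁻¹ g) (s • u)) := by
    rw [hcv, smul_smul, Module.finrank_fin_fun, abs_of_pos (by positivity),
      mul_inv_cancel₀ (by positivity), one_smul]
    rfl
  set c : ℂ := Complex.exp (Complex.I * ((hbar⁻¹ * (dot z.1 z.2 / 2) : ℝ) : ℂ)) with hc
  have hcn : ‖c‖ = 1 := by rw [hc, mul_comm, Complex.norm_exp_ofReal_mul_I]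
  have h2 : l2inner f (WH hbar z (Dil s⁻¹ g)) = c *
    VectorFourier.fourierIntegral Real.fourierChar volume LL.toLinearMap₁₂
      (GG (DilS s hs.ne' f) g (s⁻¹ • z.1)) (s⁻¹ • z.2) := by
    rw [h1, VectorFourier.fourierIntegral, ← integral_const_mul, ← integral_smul]
    congr 1
    ext u
    have e1 : s⁻¹ • (s • u - z.1) = u - s⁻¹ • z.1 := by
      rw [smul_sub, smul_smul, inv_mul_cancel₀ hs.ne', one_smul]
    have e2 : conj (Complex.exp (Complex.I *
        ((hbar⁻¹ * (dot z.2 (s • u) - dot z.1 z.2 / 2) : ℝ) : ℂ))) =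
        c * Complex.exp (((2 * Real.pi * (-(dot u (s⁻¹ • z.2))) : ℝ) : ℂ) * Complex.I) := by
      rw [← Complex.exp_conj, hc, ← Complex.exp_add]
      congr 1
      rw [map_mul, Complex.conj_I, Complex.conj_ofReal, dot_smul, dot_smul, dot_comm' u z.2]
      have : 2 * Real.pi * s⁻¹ = hbar⁻¹ * s := by
        field_simp
        linarith
      have h3 : 2 * Real.pi * -(s⁻¹ * dot z.2 u) = -(hbar⁻¹ * s * dot z.2 u) := by
        rw [← this]; ring
      rw [h3]
      push_cast
      ring
    have e3 : (LL.toLinearMap₁₂ u) (s⁻¹ • z.2) = dot u (s⁻¹ • z.2) := LL_apply _ _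
    simp only [WH, GG, Dil, DilS_coe, map_mul, Complex.conj_ofReal, e1, e2, Circle.smul_def,
      Real.fourierChar_apply, smul_eq_mul, Complex.real_smul, e3]
    rw [Real.inv_rpow hs.le, hpw]
    have : ((s ^ ((n : ℝ) / 2) : ℝ) : ℂ) ≠ 0 := by exact_mod_cast hsn
    push_cast at this ⊢
    field_simp
  rw [h2, norm_mul, hcn, one_mul]

lemma main1 (g : SchwartzMap (Rn n) ℂ) (N : ℝ) : ∃ C : ℝ, 0 < C ∧ ∃ k : ℕ,
      ∀ hbar : ℝ, 0 < hbar → hbar ≤ 1 →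
      ∀ f : SchwartzMap (Rn n) ℂ, ∀ z : Ph n,
      ‖l2inner ⇑f (WH hbar z (gh (2 * Real.pi * hbar) ⇑g))‖ ≤
        C * schNorm k (Dil (Real.sqrt (2 * Real.pi * hbar)) ⇑f) *
          (1 + sq2 ((Real.sqrt (2 * Real.pi * hbar))⁻¹ • z)) ^ (-(N / 2)) := by
  obtain ⟨m, hm⟩ := exists_nat_ge (N / 2)
  obtain ⟨C, hC, h⟩ := key g (2 * m)
  refine ⟨(n + 1) ^ m * C + 1, by positivity, 2 * m + n + 1, fun hbar hb _ f z => ?_⟩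
  have hpos : 0 < 2 * Real.pi * hbar := by positivity
  set s := Real.sqrt (2 * Real.pi * hbar) with hs
  have hs0 : 0 < s := Real.sqrt_pos.2 hpos
  have hsq : s ^ 2 = 2 * Real.pi * hbar := Real.sq_sqrt hpos.le
  unfold gh
  rw [← hs, reduce f g hbar s hb hs0 hsq z]
  have h1 := h (DilS s hs0.ne' f) (s⁻¹ • z.1) (s⁻¹ • z.2)
  rw [DilS_coe] at h1
  set V := ‖VectorFourier.fourierIntegral Real.fourierChar volume LL.toLinearMap₁₂
      (GG (DilS s hs0.ne' f) g (s⁻¹ • z.1)) (s⁻¹ • z.2)‖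
  have hV : 0 ≤ V := norm_nonneg _
  have hS := schNorm_nonneg (2 * m + n + 1) (Dil s ⇑f)
  set S := schNorm (2 * m + n + 1) (Dil s ⇑f)
  set X := 1 + sq2 (s⁻¹ • z) with hX
  have hX1 : 1 ≤ X := by
    have h1 := sq_nonneg' (s⁻¹ • z).1
    have h2 := sq_nonneg' (s⁻¹ • z).2
    rw [hX, sq2]; linarith
  have hXle : X ≤ (n + 1) * ((1 + ‖s⁻¹ • z.1‖) * (1 + ‖s⁻¹ • z.2‖)) ^ 2 := by
    have h1 := sq_le (s⁻¹ • z.1)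
    have h2 := sq_le (s⁻¹ • z.2)
    have : X = 1 + (sq (s⁻¹ • z.1) + sq (s⁻¹ • z.2)) := rfl
    rw [this]
    have hA := norm_nonneg (s⁻¹ • z.1)
    have hB := norm_nonneg (s⁻¹ • z.2)
    generalize ‖s⁻¹ • z.1‖ = A at *
    generalize ‖s⁻¹ • z.2‖ = B at *
    have hn : (0:ℝ) ≤ n := Nat.cast_nonneg n
    have h5 : 1 + A ^ 2 + B ^ 2 ≤ ((1 + A) * (1 + B)) ^ 2 := by
      have : ((1 + A) * (1 + B)) ^ 2 = 1 + A ^ 2 + B ^ 2 + (A ^ 2 * B ^ 2 + 2 * A + 2 * B + 4 * A * B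
        + 2 * A ^ 2 * B + 2 * A * B ^ 2) := by ring
      rw [this]
      exact le_add_of_nonneg_right (by positivity)
    calc _ ≤ (n + 1) * (1 + A ^ 2 + B ^ 2) := by nlinarith [sq_nonneg A, sq_nonneg B]
      _ ≤ _ := by gcongr
  have hXm : X ^ m * V ≤ (n + 1) ^ m * C * S := by
    calc X ^ m * V ≤ ((n + 1) * ((1 + ‖s⁻¹ • z.1‖) * (1 + ‖s⁻¹ • z.2‖)) ^ 2) ^ m * V := by
          gcongr
      _ = (n + 1) ^ m * (((1 + ‖s⁻¹ • z.1‖) * (1 + ‖s⁻¹ • z.2‖)) ^ (2 * m) * V) := by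
          rw [mul_pow, ← pow_mul]; ring
      _ ≤ (n + 1) ^ m * (C * S) := by gcongr
      _ = _ := by ring
  have hX0 : 0 < X := by linarith
  have hr : X ^ (N / 2) ≤ X ^ m := by
    rw [← Real.rpow_natCast]
    exact Real.rpow_le_rpow_of_exponent_le hX1 hm
  rw [Real.rpow_neg hX0.le, ← div_eq_mul_inv, le_div_iff₀ (Real.rpow_pos_of_pos hX0 _)]
  calc V * X ^ (N / 2) ≤ V * X ^ m := by gcongr
    _ = X ^ m * V := mul_comm _ _
    _ ≤ (n + 1) ^ m * C * S := hXm
    _ ≤ _ := by nlinarith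

/-- for g ∈ 𝒮(ℝⁿ) and every N ≥ 0 there are C_N > 0 and k ∈ ℕ such that for
all ħ ∈ (0,1] (h = 2πħ), all f ∈ 𝒮(ℝⁿ) and all z ∈ ℝ^{2n},
|⟨f, 𝒯̂^ħ(z)g^h⟩| ≤ C_N ‖D_{h^{1/2}}f‖_k (1+|h^{-1/2}z|²)^{-N/2}; in particular the decay
estimate is uniform over any family ℬ ⊂ 𝒮(ℝⁿ) on which the seminorms ‖D_{h^{1/2}}f‖_k are
uniformly bounded. -/
theorem stmt16 (n : ℕ) (g : SchwartzMap (Rn n) ℂ) :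
    (∀ N : ℝ, 0 ≤ N → ∃ C : ℝ, 0 < C ∧ ∃ k : ℕ,
      ∀ hbar : ℝ, 0 < hbar → hbar ≤ 1 →
      ∀ f : SchwartzMap (Rn n) ℂ, ∀ z : Ph n,
      ‖l2inner ⇑f (WH hbar z (gh (2 * Real.pi * hbar) ⇑g))‖ ≤
        C * schNorm k (Dil (Real.sqrt (2 * Real.pi * hbar)) ⇑f) *
          (1 + sq2 ((Real.sqrt (2 * Real.pi * hbar))⁻¹ • z)) ^ (-(N / 2))) ∧
    (∀ B : Set (SchwartzMap (Rn n) ℂ),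
      (∀ k : ℕ, ∃ M : ℝ, ∀ f ∈ B, ∀ hbar : ℝ, 0 < hbar → hbar ≤ 1 →
        schNorm k (Dil (Real.sqrt (2 * Real.pi * hbar)) ⇑f) ≤ M) →
      ∀ N : ℝ, 0 ≤ N → ∃ C : ℝ, 0 < C ∧
        ∀ hbar : ℝ, 0 < hbar → hbar ≤ 1 →
        ∀ f ∈ B, ∀ z : Ph n,
        ‖l2inner ⇑f (WH hbar z (gh (2 * Real.pi * hbar) ⇑g))‖ ≤
          C * (1 + sq2 ((Real.sqrt (2 * Real.pi * hbar))⁻¹ • z)) ^ (-(N / 2))) := by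
  refine ⟨fun N _ => main1 g N, fun B hB N _ => ?_⟩
  obtain ⟨C, hC, k, h⟩ := main1 g N
  obtain ⟨M, hM⟩ := hB k
  refine ⟨C * max M 1, by positivity, fun hbar h0 h1 f hf z => ?_⟩
  refine (h hbar h0 h1 f z).trans ?_
  have hle : schNorm k (Dil (Real.sqrt (2 * Real.pi * hbar)) ⇑f) ≤ max M 1 :=
    (hM f hf hbar h0 h1).trans (le_max_left _ _)
  have hx : 0 ≤ 1 + sq2 ((Real.sqrt (2 * Real.pi * hbar))⁻¹ • z) :=
    add_nonneg zero_le_one (add_nonneg (sq_nonneg' _) (sq_nonneg' _))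
  exact mul_le_mul_of_nonneg_right (mul_le_mul_of_nonneg_left hle hC.le) (Real.rpow_nonneg hx _)

end SC
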